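/- arXiv:math/9502208 — 2 statements merged into one kernel-verified Lean document; each statement's English description precedes it below -/
import Mathlib

section
/- Let A₁, A₂, B₁, B₂ be rational numbers and set S² = A₁² + A₂² + B₁² + B₂². If det(E(A₁,A₂,B₁,B₂) − (π² + 1)·I₇) = 0, i.e., if π² + 1 is an eigenvalue of E(A₁,A₂,B₁,B₂), then S² = 1/4. -/
noncomputable section

/-- The 7×7 complex matrix E(A₁,A₂,B₁,B₂) from the one-form spectrum computation
on Example III, where S² = A₁² + A₂² + B₁² + B₂². -/
def Emat (A1 A2 B1 B2 : ℝ) : Matrix (Fin 7) (Fin 7) ℂ :=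
  let p : ℂ := (Real.pi : ℂ)
  let i : ℂ := Complex.I
  let S2 : ℂ := ((A1 ^ 2 + A2 ^ 2 + B1 ^ 2 + B2 ^ 2 : ℝ) : ℂ)
  let a1 : ℂ := (A1 : ℂ)
  let a2 : ℂ := (A2 : ℂ)
  let b1 : ℂ := (B1 : ℂ)
  let b2 : ℂ := (B2 : ℂ)
  !![4*p^2*S2, 0, 0, 0, -2*p*i*b1, -2*p*i*b2, 0;
     0, 4*p^2*S2, 0, 0, -2*p*i*b2, 0, 0;
     0, 0, 4*p^2*S2, 0, 2*p*i*a1, 0, -2*p*i*b2;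
     0, 0, 0, 4*p^2*S2, 2*p*i*a2, 2*p*i*a1, 2*p*i*b1;
     2*p*i*b1, 2*p*i*b2, -2*p*i*a1, -2*p*i*a2, 4*p^2*S2 + 2, 0, 2*p*i*a1;
     2*p*i*b2, 0, 0, -2*p*i*a1, 0, 4*p^2*S2 + 1, 2*p*i*a2;
     0, 0, 2*p*i*b2, -2*p*i*b1, -2*p*i*a1, -2*p*i*a2, 4*p^2*S2 + 3]

namespace PiTr
open Polynomial

abbrev K := AlgebraicClosure ℚ

/-- multiset of subset sums -/
def SS {R : Type*} [AddCommMonoid R] (s : Multiset R) : Multiset R := s.powerset.map Multiset.sum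

lemma SS_cons {R : Type*} [AddCommMonoid R] (a : R) (s : Multiset R) :
    SS (a ::ₘ s) = SS s + (SS s).map (a + ·) := by
  simp [SS, Multiset.map_map]

lemma SS_map {R S : Type*} [AddCommMonoid R] [AddCommMonoid S] (f : R →+ S) (s : Multiset R) :
    SS (s.map f) = (SS s).map f := by
  induction s using Multiset.induction_on with
  | empty => simp [SS]
  | cons a s ih => rw [Multiset.map_cons, SS_cons, SS_cons, ih]; simp [Multiset.map_map]

lemma SS_exp (s : Multiset ℂ) :
    ((SS s).map Complex.exp).sum = (s.map (fun z => 1 + Complex.exp z)).prod := by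
  induction s using Multiset.induction_on with
  | empty => simp [SS]
  | cons a s ih =>
    rw [SS_cons, Multiset.map_cons, Multiset.prod_cons, ← ih]
    simp [Multiset.map_map, Complex.exp_add, Multiset.sum_map_mul_left, add_mul]

lemma zero_mem_SS {R : Type*} [AddCommMonoid R] (s : Multiset R) : (0 : R) ∈ SS s :=
  Multiset.mem_map.2 ⟨0, Multiset.zero_mem_powerset s, by simp⟩

lemma roots_inv (g : ℚ[X]) (σ : K ≃ₐ[ℚ] K) : (g.aroots K).map σ = g.aroots K := by
  have h := (IsAlgClosed.splits (g.map (algebraMap ℚ K))).roots_map (σ : K →+* K)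
  rw [Polynomial.map_map] at h
  have : ((σ : K →+* K).comp (algebraMap ℚ K)) = algebraMap ℚ K := RingHom.ext fun x => σ.commutes x
  rw [this] at h
  exact h.symm

instance : Algebra.IsAlgebraic ℚ K := AlgebraicClosure.isAlgebraic ℚ

instance : Algebra.IsSeparable ℚ K := Algebra.IsAlgebraic.isSeparable_of_perfectField

instance : Normal ℚ K :=
  haveI : IsAlgClosure ℚ K := ⟨inferInstance, inferInstance⟩
  IsAlgClosure.normal ℚ K

instance : IsGalois ℚ K where

lemma exists_rat (x : K) (h : ∀ σ : K ≃ₐ[ℚ] K, σ x = x) : ∃ q : ℚ, algebraMap ℚ K q = x :=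
  (InfiniteGalois.mem_range_algebraMap_iff_fixed x).2 h

lemma exists_poly (M : Multiset K) (hM : ∀ σ : K ≃ₐ[ℚ] K, M.map σ = M) :
    ∃ F : ℚ[X], F.map (algebraMap ℚ K) = (M.map (fun a => X - C a)).prod := by
  have := (lifts_iff_coeff_lifts (f := algebraMap ℚ K) (M.map (fun a => X - C a)).prod).2 ?_
  · exact (mem_lifts _).1 this
  intro n
  apply exists_rat
  intro σ
  have h : ((M.map (fun a => X - C a)).prod).map (σ : K →+* K) = (M.map (fun a => X - C a)).prod := by
    conv_rhs => rw [← hM σ]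
    rw [Polynomial.map_multiset_prod]
    simp [Multiset.map_map]
  conv_rhs => rw [← h]
  simp

lemma exists_int_poly (M : Multiset K) (hM : ∀ σ : K ≃ₐ[ℚ] K, M.map σ = M) :
    ∃ f : ℤ[X], f ≠ 0 ∧ f.aroots K = M := by
  obtain ⟨F, hF⟩ := exists_poly M hM
  obtain ⟨b, hb0, hb⟩ := IsLocalization.integerNormalization_spec (nonZeroDivisors ℤ) F
  have hF0 : F ≠ 0 := by
    rintro rfl
    have : (M.map (fun a => X - C a)).prod.Monic := monic_multiset_prod_of_monic _ _ (fun a _ => monic_X_sub_C a)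
    rw [← hF] at this
    simp at this
  have hb0' : (b : K) ≠ 0 := by exact_mod_cast nonZeroDivisors.ne_zero hb0
  set f := IsLocalization.integerNormalization (nonZeroDivisors ℤ) F with hf
  have hfm : f.map (algebraMap ℤ K) = C (b : K) * (M.map (fun a => X - C a)).prod := by
    rw [← hF, IsScalarTower.algebraMap_eq ℤ ℚ K, ← Polynomial.map_map, hb]
    ext n; simp
  have hr : f.aroots K = M := by
    rw [aroots_def, hfm, roots_C_mul _ hb0', roots_multiset_prod_X_sub_C]
  refine ⟨f, ?_, hr⟩
  intro h0
  exact hF0 ((IsLocalization.integerNormalization_eq_zero_iff le_rfl F).1 h0)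

lemma integral_eval (f : ℤ[X]) (r : K) (hr : aeval r f = 0) (g : ℤ[X]) (N : ℕ) (hN : g.natDegree ≤ N) :
    IsIntegral ℤ ((f.leadingCoeff : K) ^ N * aeval r g) := by
  have h := isIntegral_leadingCoeff_smul f r hr
  rw [aeval_eq_sum_range' (Nat.lt_succ_of_le hN), Finset.mul_sum]
  refine IsIntegral.sum _ fun i hi => ?_
  have hi : i ≤ N := by simpa [Nat.lt_succ_iff] using hi
  have : (f.leadingCoeff : K) ^ N * (g.coeff i • r ^ i) =
    ((f.leadingCoeff ^ (N - i) * g.coeff i : ℤ) : K) * (f.leadingCoeff • r) ^ i := by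
    obtain ⟨j, rfl⟩ := Nat.exists_eq_add_of_le hi
    simp [pow_add, mul_pow]; ring
  rw [this]
  exact (isIntegral_algebraMap (R := ℤ) (A := K) (x := _)).mul (h.pow i)

lemma exists_int_sum (M : Multiset K) (hM : ∀ σ : K ≃ₐ[ℚ] K, M.map σ = M) (f : ℤ[X])
    (hf : f.aroots K = M) (g : ℤ[X]) (N : ℕ) (hN : g.natDegree ≤ N) :
    ∃ z : ℤ, (z : K) = (f.leadingCoeff : K) ^ N * (M.map (fun r => aeval r g)).sum := by
  obtain ⟨q, hq⟩ := exists_rat ((f.leadingCoeff : K) ^ N * (M.map (fun r => aeval r g)).sum) (by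
    intro σ
    conv_rhs => rw [← hM σ]
    rw [map_mul, map_multiset_sum]
    simp [Multiset.map_map]
    left
    congr 1
    refine Multiset.map_congr rfl fun r _ => ?_
    exact (aeval_algHom_apply ((σ : K →ₐ[ℚ] K).restrictScalars ℤ) r g).symm)
  have hint : IsIntegral ℤ ((f.leadingCoeff : K) ^ N * (M.map (fun r => aeval r g)).sum) := by
    rw [← Multiset.sum_map_mul_left]
    refine IsIntegral.multiset_sum ?_
    intro x hx
    obtain ⟨r, hr, rfl⟩ := Multiset.mem_map.1 hx
    rw [← hf, mem_aroots] at hr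
    exact integral_eval f r hr.2 g N hN
  rw [← hq] at hint
  have : IsIntegral ℤ q := (isIntegral_algebraMap_iff (algebraMap ℚ K).injective).1 hint
  obtain ⟨z, hz⟩ := IsIntegrallyClosed.isIntegral_iff.1 this
  refine ⟨z, ?_⟩
  rw [← hq, ← hz]; simp

lemma final_analysis (D c m : ℝ) (B : ℕ) (d : ℕ) :
   ∃ p : ℕ, p.Prime ∧ B < p ∧ |D| ^ (p * d) * (m * (c ^ p / (p - 1).factorial)) < 1 := by
  have h := (FloorSemiring.tendsto_pow_div_factorial_atTop (|D| ^ d * c)).const_mul (m * (|D| ^ d * c))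
  rw [mul_zero] at h
  obtain ⟨n, hn⟩ := Filter.eventually_atTop.1 (h.eventually_lt_const (zero_lt_one))
  obtain ⟨p, hp, hp2⟩ := Nat.exists_infinite_primes (n + B + 1)
  refine ⟨p, hp2, by omega, ?_⟩
  refine lt_of_eq_of_lt ?_ (hn (p - 1) (by omega))
  obtain ⟨k, rfl⟩ : ∃ k, p = k + 1 := ⟨p - 1, by omega⟩
  have e : |D| ^ ((k + 1) * d) = (|D| ^ d) ^ k * |D| ^ d := by rw [mul_comm, pow_mul, pow_succ]
  rw [e, Nat.add_sub_cancel]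
  ring

theorem not_alg : ¬ IsAlgebraic ℚ (Real.pi * Complex.I : ℂ) := by
  intro halg
  set β : ℂ := Real.pi * Complex.I with hβ
  let ι : K →ₐ[ℚ] ℂ := IsAlgClosed.lift
  obtain ⟨g, hg0, hg⟩ := halg
  have hgr : g.aroots ℂ = (g.aroots K).map ι := by
    have h := (IsAlgClosed.splits (g.map (algebraMap ℚ K))).roots_map (ι : K →+* ℂ)
    rw [Polynomial.map_map] at h
    have : ((ι : K →+* ℂ).comp (algebraMap ℚ K)) = algebraMap ℚ ℂ := RingHom.ext fun x => ι.commutes x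
    rw [this] at h
    exact h
  have hβm : β ∈ (g.aroots K).map ι := by
    rw [← hgr, mem_aroots]; exact ⟨hg0, hg⟩
  have hprod : (((g.aroots K).map ι).map (fun z => 1 + Complex.exp z)).prod = 0 := by
    apply Multiset.prod_eq_zero
    exact Multiset.mem_map.2 ⟨β, hβm, by simp [hβ, Complex.exp_pi_mul_I]⟩
  rw [← SS_exp] at hprod
  have hS : SS ((g.aroots K).map ι) = (SS (g.aroots K)).map ι := SS_map (ι : K →+ ℂ) _
  rw [hS] at hprod
  set Q := SS (g.aroots K) with hQ
  have hQinv : ∀ σ : K ≃ₐ[ℚ] K, Q.map σ = Q := by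
    intro σ
    rw [hQ]
    conv_rhs => rw [← roots_inv g σ]
    exact (SS_map (σ : K →+ K) _).symm
  classical
  set M := Q.filter (fun x => x ≠ 0) with hMdef
  have hM : ∀ σ : K ≃ₐ[ℚ] K, M.map σ = M := by
    intro σ
    conv_rhs => rw [hMdef, ← hQinv σ, Multiset.filter_map]
    rw [hMdef]
    congr 1
    apply Multiset.filter_congr
    simp
  set k := Q.count 0 with hk
  have hkpos : 0 < k := Multiset.count_pos.2 (zero_mem_SS _)
  have hdec : Q = Multiset.replicate k 0 + M := by
    rw [hk, ← Multiset.filter_eq', hMdef, Multiset.filter_add_not]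
  rw [hdec] at hprod
  have hsum : (k : ℂ) + (M.map (fun r => Complex.exp (ι r))).sum = 0 := by
    simpa [Multiset.map_map, Function.comp_def] using hprod
  obtain ⟨f, hf0, hf⟩ := exists_int_poly M hM
  have hfe : f.eval 0 ≠ 0 := by
    intro h
    have : (0 : K) ∈ f.aroots K := by
      rw [mem_aroots]
      refine ⟨hf0, ?_⟩
      have := aeval_algebraMap_apply_eq_algebraMap_eval (A := K) (0 : ℤ) f
      simpa [h] using this
    rw [hf, hMdef] at this
    simp at this
  have hrC : ∀ r ∈ M, ι r ∈ f.aroots ℂ := by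
    intro r hr
    rw [← hf, mem_aroots] at hr
    rw [mem_aroots]
    refine ⟨hf0, ?_⟩
    have := aeval_algHom_apply (ι.restrictScalars ℤ) r f
    rw [hr.2, map_zero] at this
    exact this
  obtain ⟨c, hc⟩ := LindemannWeierstrass.exp_polynomial_approx f hfe
  obtain ⟨p, hp, hpB, hlt⟩ := final_analysis (f.leadingCoeff : ℝ) c (Multiset.card M)
    ((f.eval 0).natAbs + f.leadingCoeff.natAbs + k) f.natDegree
  obtain ⟨n, hn, gp, hgp, happ⟩ := hc p (by omega) hp
  obtain ⟨z, hz⟩ := exists_int_sum M hM f hf gp (p * f.natDegree) (by omega)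
  have hzC : (z : ℂ) = (f.leadingCoeff : ℂ) ^ (p * f.natDegree) *
      (M.map (fun r => aeval (ι r) gp)).sum := by
    have := congrArg ι hz
    rw [map_intCast, map_mul, map_pow, map_intCast, map_multiset_sum, Multiset.map_map] at this
    rw [this]
    congr 2
    refine Multiset.map_congr rfl fun r _ => ?_
    exact (aeval_algHom_apply (ι.restrictScalars ℤ) r gp).symm
  set a := f.leadingCoeff with ha
  set N := p * f.natDegree with hN
  have hsmall : ‖((a ^ N * (n * k) + p * z : ℤ) : ℂ)‖ < 1 := by
    have e : ((a ^ N * (n * k) + p * z : ℤ) : ℂ) =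
        -((a : ℂ) ^ N * (M.map (fun r => n • Complex.exp (ι r) - p • aeval (ι r) gp)).sum) := by
      rw [Multiset.sum_map_sub]
      simp only [zsmul_eq_mul, nsmul_eq_mul, Multiset.sum_map_mul_left]
      push_cast
      rw [hzC]
      have : (M.map (fun r => Complex.exp (ι r))).sum = - (k : ℂ) := by linear_combination hsum
      rw [this]; ring
    rw [e, norm_neg, norm_mul, norm_pow]
    refine lt_of_le_of_lt ?_ hlt
    have : ‖(a : ℂ)‖ = |(a : ℝ)| := by simp
    rw [this]
    gcongr
    refine (Multiset.le_sum_of_subadditive (fun x : ℂ => ‖x‖) norm_zero.le norm_add_le _).trans ?_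
    rw [← nsmul_eq_mul, Multiset.map_map]
    have := Multiset.sum_le_card_nsmul (M.map ((fun x : ℂ => ‖x‖) ∘ fun r => n • Complex.exp (ι r) - p • aeval (ι r) gp))
      (c ^ p / (p - 1).factorial) (by
        intro x hx
        obtain ⟨r, hr, rfl⟩ := Multiset.mem_map.1 hx
        exact happ (hrC r hr))
    simpa using this
  have hz0 : a ^ N * (n * k) + p * z = 0 := by
    rw [Complex.norm_intCast] at hsmall
    exact Int.abs_lt_one_iff.1 (by exact_mod_cast hsmall)
  have hpZ : Prime (p : ℤ) := Nat.prime_iff_prime_int.1 hp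
  have hd : (p : ℤ) ∣ a ^ N * (n * k) := ⟨-z, by linear_combination hz0⟩
  rcases hpZ.dvd_or_dvd hd with h | h
  · have h := Int.natCast_dvd.1 (hpZ.dvd_of_dvd_pow h)
    have := Nat.le_of_dvd (Int.natAbs_pos.2 (leadingCoeff_ne_zero.2 hf0)) h
    omega
  · rcases hpZ.dvd_or_dvd h with h | h
    · exact hn h
    · have := Nat.le_of_dvd hkpos (Int.natCast_dvd_natCast.1 h)
      omega

lemma alg_I : IsAlgebraic ℚ Complex.I :=
  ⟨X ^ 2 + 1, (by
    intro h
    have := congrArg (Polynomial.eval 0) h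
    simp at this), by simp⟩

theorem not_alg_pi : ¬ IsAlgebraic ℚ (Real.pi : ℂ) := fun h => not_alg (h.mul alg_I)

end PiTr

open Polynomial in
theorem PiTr.key (B C : Matrix (Fin 7) (Fin 7) (algebraicClosure ℚ ℂ)) (c : algebraicClosure ℚ ℂ) (hc : c ≠ 0)
    (h : ((Real.pi : ℂ) ^ 2 • (c : ℂ) • (1 : Matrix (Fin 7) (Fin 7) ℂ) +
      (Real.pi : ℂ) • B.map (algebraMap _ ℂ) + C.map (algebraMap _ ℂ)).det = 0) : False := by
  have hpi : (Real.pi : ℂ) ≠ 0 := by exact_mod_cast Real.pi_ne_zero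
  let P : Matrix (Fin 7) (Fin 7) (algebraicClosure ℚ ℂ)[X] :=
    Polynomial.C c • 1 + (X : (algebraicClosure ℚ ℂ)[X]) • B.map Polynomial.C +
      (X ^ 2 : (algebraicClosure ℚ ℂ)[X]) • C.map Polynomial.C
  have h0 : P.det.eval 0 = c ^ 7 := by
    have := RingHom.map_det (evalRingHom (0 : algebraicClosure ℚ ℂ)) P
    rw [coe_evalRingHom] at this
    rw [this]
    have e : (evalRingHom (0 : algebraicClosure ℚ ℂ)).mapMatrix P = c • 1 := by
      ext i j
      simp [P, Matrix.one_apply]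
      split_ifs <;> simp
    rw [e, Matrix.det_smul]; simp
  have h1 : aeval ((Real.pi : ℂ)⁻¹) P.det = 0 := by
    have := AlgHom.map_det (aeval (R := algebraicClosure ℚ ℂ) ((Real.pi : ℂ)⁻¹)) P
    rw [this]
    have e : (aeval (R := algebraicClosure ℚ ℂ) ((Real.pi : ℂ)⁻¹)).mapMatrix P =
      ((Real.pi : ℂ)⁻¹ ^ 2) • ((Real.pi : ℂ) ^ 2 • (c : ℂ) • (1 : Matrix (Fin 7) (Fin 7) ℂ) +
      (Real.pi : ℂ) • B.map (algebraMap _ ℂ) + C.map (algebraMap _ ℂ)) := by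
      ext i j
      have e2 : (aeval (R := algebraicClosure ℚ ℂ) ((Real.pi : ℂ)⁻¹)) ((1 : Matrix (Fin 7) (Fin 7) (algebraicClosure ℚ ℂ)[X]) i j) = (1 : Matrix (Fin 7) (Fin 7) ℂ) i j := by
        rw [Matrix.one_apply, Matrix.one_apply]; split_ifs <;> simp
      simp only [P, AlgHom.mapMatrix_apply, Matrix.map_apply, Matrix.add_apply, Matrix.smul_apply, smul_eq_mul, map_add, map_mul, map_pow, aeval_X, aeval_C, e2]
      change (c : ℂ) * _ + _ + _ = _
      field_simp
    rw [e, Matrix.det_smul, h, mul_zero]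
  have halg : IsAlgebraic (algebraicClosure ℚ ℂ) ((Real.pi : ℂ)⁻¹) :=
    ⟨P.det, (by
      intro h
      rw [h, eval_zero] at h0
      exact pow_ne_zero 7 hc h0.symm), h1⟩
  have halg2 : IsAlgebraic ℚ ((Real.pi : ℂ)⁻¹) :=
    haveI : Algebra.IsAlgebraic ℚ (algebraicClosure ℚ ℂ) := algebraicClosure.isAlgebraic ℚ ℂ
    halg.restrictScalars ℚ
  have := halg2.inv
  rw [inv_inv] at this
  exact PiTr.not_alg_pi this

/-- If A₁,A₂,B₁,B₂ are rational and π² + 1 is an eigenvalue of E(A₁,A₂,B₁,B₂),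
then S² = A₁² + A₂² + B₁² + B₂² = 1/4. -/
theorem stmt15 (A1 A2 B1 B2 : ℚ)
    (h : (Emat (A1 : ℝ) (A2 : ℝ) (B1 : ℝ) (B2 : ℝ) -
        ((Real.pi : ℂ) ^ 2 + 1) • (1 : Matrix (Fin 7) (Fin 7) ℂ)).det = 0) :
    A1 ^ 2 + A2 ^ 2 + B1 ^ 2 + B2 ^ 2 = 1 / 4 := by
  by_contra hne
  let i : algebraicClosure ℚ ℂ := ⟨Complex.I, mem_algebraicClosure_iff.2 PiTr.alg_I⟩
  let q : ℚ →+* algebraicClosure ℚ ℂ := algebraMap ℚ _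
  have hq : ∀ x : ℚ, ((q x : algebraicClosure ℚ ℂ) : ℂ) = (x : ℂ) := fun x => by
    simp [q]
  have hi : (i : ℂ) = Complex.I := rfl
  refine PiTr.key
    !![0, 0, 0, 0, -2*i*q B1, -2*i*q B2, 0;
     0, 0, 0, 0, -2*i*q B2, 0, 0;
     0, 0, 0, 0, 2*i*q A1, 0, -2*i*q B2;
     0, 0, 0, 0, 2*i*q A2, 2*i*q A1, 2*i*q B1;
     2*i*q B1, 2*i*q B2, -2*i*q A1, -2*i*q A2, 0, 0, 2*i*q A1;
     2*i*q B2, 0, 0, -2*i*q A1, 0, 0, 2*i*q A2;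
     0, 0, 2*i*q B2, -2*i*q B1, -2*i*q A1, -2*i*q A2, 0]
    (Matrix.diagonal ![-1, -1, -1, -1, 1, 0, 2])
    (q (4 * (A1 ^ 2 + A2 ^ 2 + B1 ^ 2 + B2 ^ 2) - 1)) ?_ ?_
  · rw [Ne, map_eq_zero]
    intro h0
    apply hne
    linarith
  · refine Eq.trans ?_ h
    congr 1
    have hA : ∀ x : algebraicClosure ℚ ℂ, algebraMap (algebraicClosure ℚ ℂ) ℂ x = (x : ℂ) := fun x => rfl
    have h2 : ((2 : algebraicClosure ℚ ℂ) : ℂ) = 2 := rfl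
    rw [hq]
    ext r s
    fin_cases r <;> fin_cases s <;>
      simp [Emat, hA, h2, hi, Matrix.diagonal] <;> ring
end
end

section
/- Let A₁, B₁, B₂ be rational numbers and set S² = A₁² + B₁² + B₂². If det(E'(A₁,B₁,B₂) − (π² + 1)·I₅) = 0, i.e., if π² + 1 is an eigenvalue of E'(A₁,B₁,B₂), then S² = 1/4. -/
noncomputable section

/-- The 5×5 complex matrix E'(A₁,B₁,B₂) from the one-form spectrum computation
on Example IV, where S² = A₁² + B₁² + B₂². -/
def Emat' (A1 B1 B2 : ℝ) : Matrix (Fin 5) (Fin 5) ℂ :=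
  let p : ℂ := (Real.pi : ℂ)
  let i : ℂ := Complex.I
  let S2 : ℂ := ((A1 ^ 2 + B1 ^ 2 + B2 ^ 2 : ℝ) : ℂ)
  let a1 : ℂ := (A1 : ℂ)
  let b1 : ℂ := (B1 : ℂ)
  let b2 : ℂ := (B2 : ℂ)
  !![4*p^2*S2, 0, 0, -2*p*i*b1, 0;
     0, 4*p^2*S2, 0, 2*p*i*a1, -2*p*i*b2;
     0, 0, 4*p^2*S2, 0, 2*p*i*b1;
     2*p*i*b1, -2*p*i*a1, 0, 4*p^2*S2 + 1, 2*p*i*a1;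
     0, 2*p*i*b2, -2*p*i*b1, -2*p*i*a1, 4*p^2*S2 + 2]

open Polynomial

theorem galois_sum {K : Type*} [Field K] [Algebra ℚ K] [IsGalois ℚ K] [DecidableEq K] (R : Finset K)
    (hR : ∀ (σ : K ≃ₐ[ℚ] K), ∀ x ∈ R, σ x ∈ R) (h : K → K)
    (hh : ∀ (σ : K ≃ₐ[ℚ] K) x, σ (h x) = h (σ x)) :
    ∃ q : ℚ, algebraMap ℚ K q = ∑ T ∈ R.powerset, h (∑ x ∈ T, x) := by
  apply (InfiniteGalois.mem_range_algebraMap_iff_fixed _).2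
  intro σ
  rw [map_sum]
  refine Finset.sum_nbij' (fun T => T.image σ) (fun T => T.image σ.symm) ?_ ?_ ?_ ?_ ?_
  · intro T hT
    rw [Finset.mem_powerset] at *
    intro y hy
    obtain ⟨x, hx, rfl⟩ := Finset.mem_image.1 hy
    exact hR σ x (hT hx)
  · intro T hT
    rw [Finset.mem_powerset] at *
    intro y hy
    obtain ⟨x, hx, rfl⟩ := Finset.mem_image.1 hy
    exact hR σ.symm x (hT hx)
  · intro T _; simp [Finset.image_image, Function.comp_def]
  · intro T _; simp [Finset.image_image, Function.comp_def]
  · intro T _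
    rw [hh, map_sum, Finset.sum_image (fun a _ b _ hab => σ.injective hab)]

theorem exists_int_poly {K : Type*} [Field K] [Algebra ℚ K] (x : K) (hx : IsAlgebraic ℚ x) (h0 : x ≠ 0) :
    ∃ f : ℤ[X], f.eval 0 ≠ 0 ∧ aeval x f = 0 := by
  have hx' : IsAlgebraic ℤ x := (IsFractionRing.isAlgebraic_iff ℤ ℚ K).2 hx
  obtain ⟨f, hf, hfx⟩ := hx'
  obtain ⟨q, hq, hnd⟩ := exists_eq_pow_rootMultiplicity_mul_and_not_dvd f hf 0
  refine ⟨q, ?_, ?_⟩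
  · intro h; exact hnd (dvd_iff_isRoot.2 h)
  · rw [hq] at hfx
    simpa [h0] using hfx

theorem int_scale {K : Type*} [Field K] [Algebra ℚ K] (x : K) (f g : ℤ[X]) (hx : aeval x f = 0)
    (N : ℕ) (hN : g.natDegree ≤ N) : IsIntegral ℤ ((f.leadingCoeff : K) ^ N * aeval x g) := by
  have h1 : IsIntegral ℤ ((f.leadingCoeff : K) * x) := by
    have := isIntegral_leadingCoeff_smul f x hx
    simpa [Algebra.smul_def] using this
  rw [aeval_eq_sum_range' (Nat.lt_succ_of_le hN), Finset.mul_sum]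
  refine IsIntegral.sum _ fun i hi => ?_
  have hi' : i ≤ N := by simpa [Nat.lt_succ_iff] using hi
  have : (f.leadingCoeff : K) ^ N * (g.coeff i • x ^ i) =
    (((f.leadingCoeff ^ (N - i) * g.coeff i : ℤ)) : K) * (f.leadingCoeff * x) ^ i := by
    obtain ⟨k, rfl⟩ := Nat.exists_eq_add_of_le hi'
    rw [Nat.add_sub_cancel_left]
    push_cast [zsmul_eq_mul]
    ring
  rw [this]
  exact (isIntegral_intCast _).mul (h1.pow i)

theorem exists_good_prime (D M : ℝ) (B : ℕ) : ∃ p : ℕ, p.Prime ∧ B < p ∧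
    M * (D ^ p / (p - 1).factorial) < 1 := by
  have h := (FloorSemiring.tendsto_pow_div_factorial_atTop D).const_mul (M * D)
  rw [mul_zero] at h
  obtain ⟨n0, hn0⟩ := Filter.eventually_atTop.1 (h.eventually (gt_mem_nhds (zero_lt_one)))
  obtain ⟨p, hp, hpp⟩ := Nat.exists_infinite_primes (max n0 B + 1)
  refine ⟨p, hpp, by omega, ?_⟩
  have := hn0 (p - 1) (by omega)
  obtain ⟨m, rfl⟩ : ∃ m, p = m + 1 := ⟨p - 1, by omega⟩
  rw [Nat.add_sub_cancel] at *
  calc _ = _ := by ring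
    _ < 1 := this

theorem no_vanish {K : Type*} [Field K] [Algebra ℚ K] [IsGalois ℚ K] [DecidableEq K]
    (φ : K →ₐ[ℚ] ℂ) (R : Finset K)
    (hR : ∀ (σ : K ≃ₐ[ℚ] K), ∀ x ∈ R, σ x ∈ R) :
    ∑ T ∈ R.powerset, Complex.exp (φ (∑ x ∈ T, x)) ≠ 0 := by
  intro hsum
  set s : Finset K → K := fun T => ∑ x ∈ T, x with hs
  set S := R.powerset.filter (fun T => s T ≠ 0) with hS
  set Z := R.powerset.filter (fun T => ¬ s T ≠ 0) with hZ
  have hk : 0 < Z.card := by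
    refine Finset.card_pos.2 ⟨∅, ?_⟩
    simp [hZ, hs]
  have hexp : ∑ T ∈ S, Complex.exp (φ (s T)) = -(Z.card : ℂ) := by
    rw [← Finset.sum_filter_add_sum_filter_not _ (fun T => s T ≠ 0)] at hsum
    have : ∑ T ∈ Z, Complex.exp (φ (s T)) = Z.card := by
      rw [Finset.sum_congr rfl (g := fun _ => (1 : ℂ)), Finset.sum_const]
      · simp
      · intro T hT
        have : s T = 0 := by
          have := (Finset.mem_filter.1 hT).2
          simpa using this
        simp [this]
    exact eq_neg_of_add_eq_zero_left (by rw [← this]; exact hsum)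
  have hF : ∀ x : K, ∃ f : ℤ[X], f.eval 0 ≠ 0 ∧ (x ≠ 0 → aeval x f = 0) := by
    intro x
    by_cases hx : x = 0
    · exact ⟨1, by simp, fun h => absurd hx h⟩
    · obtain ⟨f, h1, h2⟩ := exists_int_poly x (Algebra.IsAlgebraic.isAlgebraic x) hx
      exact ⟨f, h1, fun _ => h2⟩
  choose F hF0 hFx using hF
  set f : ℤ[X] := ∏ T ∈ S, F (s T) with hf
  have hf0 : f.eval 0 ≠ 0 := by
    rw [hf, eval_prod]
    exact Finset.prod_ne_zero_iff.2 fun T _ => hF0 _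
  have hfne : f ≠ 0 := by
    intro h; rw [h] at hf0; simp at hf0
  have hfx : ∀ T ∈ S, aeval (s T) f = 0 := by
    intro T hT
    rw [hf, map_prod]
    exact Finset.prod_eq_zero hT (hFx _ (Finset.mem_filter.1 hT).2)
  have hroot : ∀ T ∈ S, φ (s T) ∈ f.aroots ℂ := by
    intro T hT
    rw [mem_aroots]
    refine ⟨hfne, ?_⟩
    have : aeval (φ (s T)) f = φ (aeval (s T) f) := by
      simpa using (aeval_algHom_apply (φ.restrictScalars ℤ) (s T) f)
    rw [this, hfx T hT, map_zero]
  obtain ⟨c, hc⟩ := LindemannWeierstrass.exp_polynomial_approx f hf0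
  set a := f.leadingCoeff with ha
  have ha0 : a ≠ 0 := leadingCoeff_ne_zero.2 hfne
  obtain ⟨p, hp, hpB, hpM⟩ := exists_good_prime (|(a : ℝ)| ^ f.natDegree * |c|) S.card
    ((f.eval 0).natAbs + a.natAbs + Z.card)
  obtain ⟨n, hn, g, hg, hgr⟩ := hc p (by omega) hp
  -- the integer J
  obtain ⟨q, hq⟩ := galois_sum R hR (fun x => if x ≠ 0 then aeval x g else 0) (by
    intro σ x
    by_cases hx : x = 0
    · simp [hx]
    · simp only [ne_eq, hx, not_false_eq_true, if_true, EmbeddingLike.map_eq_zero_iff]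
      simpa using (aeval_algHom_apply (σ.toAlgHom.restrictScalars ℤ) x g).symm)
  rw [← Finset.sum_filter (fun T => s T ≠ 0) (fun T => aeval (s T) g)] at hq
  set N := p * f.natDegree with hN
  have hJ : IsIntegral ℤ ((a : ℚ) ^ N * q) := by
    rw [← isIntegral_algebraMap_iff (algebraMap ℚ K).injective (A := ℚ)]
    rw [map_mul, map_pow, hq, Finset.mul_sum]
    refine IsIntegral.sum _ fun T hT => ?_
    have := int_scale (s T) f g (hfx T hT) N (by omega)
    simpa using this
  obtain ⟨J, hJ⟩ := IsIntegrallyClosed.isIntegral_iff.1 hJ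
  have hJC : (J : ℂ) = (a : ℂ) ^ N * ∑ T ∈ S, aeval (φ (s T)) g := by
    have h1 : ∑ T ∈ S, aeval (φ (s T)) g = (q : ℂ) := by
      have := congrArg φ hq
      rw [map_sum, AlgHom.commutes] at this
      have h2 : (algebraMap ℚ ℂ q) = (q : ℂ) := by simp
      rw [← h2, this]
      refine Finset.sum_congr rfl fun T _ => ?_
      simpa using (aeval_algHom_apply (φ.restrictScalars ℤ) (s T) g)
    rw [h1]
    have h3 : (J : ℚ) = (a : ℚ) ^ N * q := by simpa using hJ
    exact_mod_cast congrArg (fun z : ℚ => (z : ℂ)) h3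
  set I : ℤ := a ^ N * n * Z.card + p * J with hI
  have hIC : (I : ℂ) = -(a : ℂ) ^ N * ∑ T ∈ S, (n • Complex.exp (φ (s T)) - p • aeval (φ (s T)) g) := by
    rw [Finset.sum_sub_distrib, ← Finset.smul_sum, ← Finset.smul_sum, hexp, hI]
    push_cast
    rw [hJC]
    simp only [zsmul_eq_mul, nsmul_eq_mul]
    ring
  have hle : ‖(I : ℂ)‖ < 1 := by
    refine lt_of_le_of_lt ?_ hpM
    rw [hIC, norm_mul, norm_neg, norm_pow, Complex.norm_intCast]
    have h1 : ‖∑ T ∈ S, (n • Complex.exp (φ (s T)) - p • aeval (φ (s T)) g)‖ ≤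
        S.card * (|c| ^ p / (p - 1).factorial) := by
      refine (norm_sum_le_of_le S (f := _) (n := fun _ => |c| ^ p / ((p - 1).factorial : ℝ)) ?_).trans ?_
      · intro T hT
        refine (hgr (hroot T hT)).trans ?_
        have : c ^ p ≤ |c| ^ p := by
          rw [← abs_pow]
          exact le_abs_self _
        gcongr ?_ / _
      · simp
    calc |(a : ℝ)| ^ N * _ ≤ |(a : ℝ)| ^ N * (S.card * (|c| ^ p / (p - 1).factorial)) := by gcongr
      _ = _ := by rw [mul_pow, ← pow_mul, hN, mul_comm p]; ring
  have hI0 : I = 0 := by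
    rw [Complex.norm_intCast] at hle
    have : |I| < 1 := by exact_mod_cast hle
    exact Int.abs_lt_one_iff.1 this
  have hpi : Prime (p : ℤ) := Nat.prime_iff_prime_int.1 hp
  have hdvd : (p : ℤ) ∣ a ^ N * n * Z.card := by
    have : a ^ N * n * Z.card = p * (-J) := by linarith
    exact ⟨_, this⟩
  rcases hpi.dvd_or_dvd hdvd with h | h
  · rcases hpi.dvd_or_dvd h with h | h
    · have h := hpi.dvd_of_dvd_pow h
      have := Int.natAbs_dvd_natAbs.2 h
      have := Nat.le_of_dvd (Int.natAbs_pos.2 ha0) this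
      simp at this; omega
    · exact hn h
  · have := Nat.le_of_dvd hk (by exact_mod_cast h)
    omega

theorem pi_I_aux {K : Type*} [Field K] {_ : Algebra ℚ K} (hK : IsAlgClosure ℚ K)
    (φ : K →ₐ[ℚ] ℂ) (α : K) (hα : φ α = (Real.pi : ℂ) * Complex.I) : False := by
  classical
  have : IsGalois ℚ K := IsAlgClosure.isGalois ℚ K
  let m := minpoly ℚ α
  have hm : m ≠ 0 := minpoly.ne_zero (Algebra.IsAlgebraic.isAlgebraic α).isIntegral
  refine no_vanish φ (m.aroots K).toFinset ?_ ?_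
  · intro σ x hx
    rw [Multiset.mem_toFinset, mem_aroots] at *
    refine ⟨hm, ?_⟩
    have : aeval (σ x) m = σ (aeval x m) := by
      simpa using (aeval_algHom_apply σ.toAlgHom x m)
    rw [this, hx.2, map_zero]
  · simp only [map_sum, Complex.exp_sum]
    rw [← Finset.prod_one_add]
    refine Finset.prod_eq_zero (i := α) ?_ ?_
    · rw [Multiset.mem_toFinset, mem_aroots]
      exact ⟨hm, minpoly.aeval ℚ α⟩
    · rw [hα, Complex.exp_pi_mul_I]; ring

theorem transcendental_pi_I : Transcendental ℚ ((Real.pi : ℂ) * Complex.I) := by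
  intro halg
  exact pi_I_aux (algebraicClosure.isAlgClosure ℚ ℂ) (algebraicClosure ℚ ℂ).val
    ⟨_, mem_algebraicClosure_iff.2 halg⟩ rfl

theorem transcendental_pi_complex : Transcendental ℚ (Real.pi : ℂ) := by
  intro h
  refine transcendental_pi_I (h.mul ?_)
  refine ⟨X ^ 2 + 1, ?_, by simp⟩
  exact (by monicity! : (X ^ 2 + 1 : ℚ[X]).Monic).ne_zero

theorem det_five (x u v w y z : ℂ) :
    (!![x, 0, 0, -u, 0;
       0, x, 0, v, -w;
       0, 0, x, 0, u;
       u, -v, 0, y, v;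
       0, w, -u, -v, z] : Matrix (Fin 5) (Fin 5) ℂ).det =
    x * ((x * y + u ^ 2 + v ^ 2) * (x * z + u ^ 2 + w ^ 2) + v ^ 2 * x ^ 2 - v ^ 2 * w ^ 2) := by
  rw [Matrix.det_succ_row_zero]
  simp [Fin.sum_univ_succ, Matrix.det_succ_row_zero, Fin.succAbove]
  ring

theorem emat_det (A B C : ℝ) (l : ℂ) :
    (Emat' A B C - l • (1 : Matrix (Fin 5) (Fin 5) ℂ)).det =
    (let x : ℂ := 4 * (Real.pi : ℂ) ^ 2 * (A ^ 2 + B ^ 2 + C ^ 2) - l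
     let t : ℂ := (Real.pi : ℂ) ^ 2
     x * ((x * (x + 1) - 4 * t * (A ^ 2 + B ^ 2)) * (x * (x + 2) - 4 * t * (B ^ 2 + C ^ 2))
       - 4 * t * A ^ 2 * x ^ 2 - 16 * t ^ 2 * A ^ 2 * C ^ 2)) := by
  have hI : Complex.I ^ 2 = -1 := Complex.I_sq
  have hm : Emat' A B C - l • (1 : Matrix (Fin 5) (Fin 5) ℂ) =
      (let x : ℂ := 4 * (Real.pi : ℂ) ^ 2 * (A ^ 2 + B ^ 2 + C ^ 2) - l
       let u : ℂ := 2 * Real.pi * Complex.I * B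
       let v : ℂ := 2 * Real.pi * Complex.I * A
       let w : ℂ := 2 * Real.pi * Complex.I * C
       !![x, 0, 0, -u, 0;
       0, x, 0, v, -w;
       0, 0, x, 0, u;
       u, -v, 0, x + 1, v;
       0, w, -u, -v, x + 2]) := by
    ext i j
    fin_cases i <;> fin_cases j <;> simp [Emat'] <;> ring
  rw [hm]
  simp only [det_five, mul_pow, hI]
  ring

/-- If A₁,B₁,B₂ are rational and π² + 1 is an eigenvalue of E'(A₁,B₁,B₂),
then S² = A₁² + B₁² + B₂² = 1/4. -/
theorem stmt17 (A1 B1 B2 : ℚ)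
    (h : (Emat' (A1 : ℝ) (B1 : ℝ) (B2 : ℝ) -
        ((Real.pi : ℂ) ^ 2 + 1) • (1 : Matrix (Fin 5) (Fin 5) ℂ)).det = 0) :
    A1 ^ 2 + B1 ^ 2 + B2 ^ 2 = 1 / 4 := by
  rw [emat_det] at h
  set c : ℚ := 4 * (A1 ^ 2 + B1 ^ 2 + B2 ^ 2) - 1 with hc
  let P1 : ℚ[X] := C c * X ^ 2 - 1
  let P3 : ℚ[X] := (C (c ^ 2) * X ^ 2 - C (c + 4 * (A1 ^ 2 + B1 ^ 2))) *
    (C (c ^ 2) * X ^ 4 - 1 - C (4 * (B1 ^ 2 + B2 ^ 2)) * X ^ 2) -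
    C (4 * A1 ^ 2) * (C c * X ^ 2 - 1) ^ 2 - C (16 * A1 ^ 2 * B2 ^ 2) * X ^ 2
  have hP : aeval (Real.pi : ℂ) (P1 * X ^ 2 * P3) = 0 := by
    rw [← h]
    simp only [P1, P3, map_mul, map_sub, map_pow, map_one, aeval_X, aeval_C, eq_ratCast, hc]
    push_cast
    ring
  have h0 : P1 * X ^ 2 * P3 = 0 := by
    by_contra hne
    exact transcendental_pi_complex ⟨_, hne, hP⟩
  rcases mul_eq_zero.1 h0 with h1 | h3
  · rcases mul_eq_zero.1 h1 with h1 | h1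
    · have := congrArg (eval 0) h1
      simp [P1] at this
    · exact absurd h1 (pow_ne_zero _ X_ne_zero)
  · have e0 := congrArg (eval 0) h3
    have e1 := congrArg (eval 1) h3
    have e2 := congrArg (eval 2) h3
    have e3 := congrArg (eval 3) h3
    simp only [P3, eval_sub, eval_mul, eval_C, eval_pow, eval_X, eval_one, eval_zero] at e0 e1 e2 e3
    -- values at s = 0, 1, 4, 9 of the cubic with leading coefficient c ^ 4
    have : c ^ 4 = 0 := by
      linear_combination (-1/36) * e0 + (1/24) * e1 - (1/60) * e2 + (1/360) * e3
    have hc0 : c = 0 := by simpa using this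
    linarith
end
end
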